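/- Let (e,h,f) be an sl₂-triple in Matrix (Fin n) (Fin n) ℂ, let W := {A : Matrix (Fin n) (Fin n) ℂ | h*A - A*h = -A} be the (−1)-eigenspace of ad h, and define ψ(A,A') := Matrix.trace ((e*A - A*e) * A'). Then: (a) ψ(A,A') = -ψ(A',A) for all A, A' : Matrix (Fin n) (Fin n) ℂ (ψ is alternating); (b) if A ∈ W and ψ(A,A') = 0 for all A' ∈ W, then A = 0 (ψ is non-degenerate on W); (c) the dimension Module.finrank ℂ W is even. -/

import Mathlib

/-- The `(-1)`-eigenspace `{A | h*A - A*h = -A}` of `ad h` on `Matrix (Fin n) (Fin n) ℂ`,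
as a `ℂ`-submodule. -/
noncomputable def negOneEigenspace (n : ℕ) (h : Matrix (Fin n) (Fin n) ℂ) :
    Submodule ℂ (Matrix (Fin n) (Fin n) ℂ) where
  carrier := {A | h * A - A * h = -A}
  add_mem' := by
    intro a b ha hb
    simp only [Set.mem_setOf_eq] at ha hb ⊢
    have key : h * (a + b) - (a + b) * h = (h * a - a * h) + (h * b - b * h) := by
      noncomm_ring
    rw [key, ha, hb, neg_add]
  zero_mem' := by simp
  smul_mem' := by
    intro c a ha
    simp only [Set.mem_setOf_eq] at ha ⊢
    have key : h * (c • a) - (c • a) * h = c • (h * a - a * h) := by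
      rw [Matrix.mul_smul, Matrix.smul_mul, smul_sub]
    rw [key, ha, smul_neg]


namespace Stmt11

section
variable {V : Type*} [AddCommGroup V] [Module ℂ V] [FiniteDimensional ℂ V]

lemma bounded_weights (H : Module.End ℂ V) (a c : ℂ) (hc : c ≠ 0) :
    ∃ K : ℕ, ∀ k : ℕ, K ≤ k → ∀ v : V, H v = (a + c * k) • v → v = 0 := by
  have hfin : Set.Finite {k : ℕ | H.HasEigenvalue (a + c * k)} := by
    have h1 : Set.Finite {μ : ℂ | H.HasEigenvalue μ} := Module.End.finite_hasEigenvalue H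
    refine h1.preimage (f := fun k : ℕ => a + c * (k : ℂ)) ?_
    intro x _ y _ hxy
    have : c * (x : ℂ) = c * y := add_left_cancel hxy
    exact_mod_cast mul_left_cancel₀ hc this
  obtain ⟨K, hK⟩ := hfin.bddAbove
  refine ⟨K + 1, fun k hk v hv => ?_⟩
  by_contra hne
  have : k ≤ K := hK (Module.End.hasEigenvalue_of_hasEigenvector
    (Module.End.hasEigenvector_iff.mpr ⟨Module.End.mem_eigenspace_iff.mpr hv, hne⟩))
  omega

lemma EF_inj (H E F : Module.End ℂ V)
    (hE : ∀ v, H (E v) = E (H v) + (2 : ℂ) • E v)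
    (hEF : ∀ v, E (F v) = F (E v) + H v)
    (ν : ℕ) (hν : 0 < ν) (v : V) (hv : H v = (ν : ℂ) • v) (h0 : E (F v) = 0) :
    v = 0 := by
  have hw : ∀ k : ℕ, H ((E ^ k) v) = ((ν : ℂ) + 2 * k) • (E ^ k) v := by
    intro k
    induction k with
    | zero => simp [hv]
    | succ k ih =>
      rw [pow_succ', Module.End.mul_apply, hE, ih, map_smul, ← add_smul]
      congr 1; push_cast; ring
  have hf : ∀ k : ℕ, F ((E ^ (k + 1)) v) = (-((k : ℂ) + 1) * (ν + k)) • (E ^ k) v := by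
    intro k
    induction k with
    | zero =>
      have := hEF v
      rw [h0, hv] at this
      simp only [zero_add, pow_one, pow_zero, Module.End.one_apply]
      rw [eq_comm, add_eq_zero_iff_eq_neg] at this
      rw [this, ← neg_smul]; congr 1; push_cast; ring
    | succ k ih =>
      have := hEF ((E ^ (k + 1)) v)
      rw [ih, map_smul, hw, ← Module.End.mul_apply E (E ^ k), ← pow_succ',
        ← Module.End.mul_apply E (E ^ (k+1)), ← pow_succ' E (k + 1)] at this
      rw [← sub_eq_iff_eq_add, ← sub_smul] at this
      rw [← this]; congr 1; push_cast; ring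
  by_contra hne
  have hnz : ∀ k : ℕ, (E ^ k) v ≠ 0 := by
    intro k
    induction k with
    | zero => simpa using hne
    | succ k ih =>
      intro h
      have := hf k
      rw [h, map_zero, eq_comm, smul_eq_zero] at this
      rcases this with h | h
      · have h1 : ((k : ℂ) + 1) ≠ 0 := by exact_mod_cast Nat.succ_ne_zero k
        have h2 : ((ν : ℂ) + k) ≠ 0 := by exact_mod_cast (by omega : ν + k ≠ 0)
        exact mul_ne_zero (neg_ne_zero.mpr h1) h2 h
      · exact ih h
  obtain ⟨K, hK⟩ := bounded_weights H ν 2 two_ne_zero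
  exact hnz K (hK K le_rfl _ (hw K))

lemma prim_formula (H E F : Module.End ℂ V)
    (hF : ∀ v, H (F v) = F (H v) - (2 : ℂ) • F v)
    (hEF : ∀ v, E (F v) = F (E v) + H v)
    (μ : ℂ) (u v : V) (hu : H u = μ • u) (hv : H v = μ • v + u)
    (hEv : E v = 0) (k : ℕ) :
    H ((F ^ k) v) = (μ - 2 * k) • (F ^ k) v + (F ^ k) u ∧
    E ((F ^ (k + 1)) v) = (((k : ℂ) + 1) * (μ - k)) • (F ^ k) v + ((k : ℂ) + 1) • (F ^ k) u := by
  have hw : ∀ k : ℕ, H ((F ^ k) v) = (μ - 2 * k) • (F ^ k) v + (F ^ k) u := by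
    intro k
    induction k with
    | zero => simp [hv]
    | succ k ih =>
      rw [pow_succ', Module.End.mul_apply, hF, ih, map_add, map_smul, Module.End.mul_apply]
      push_cast; module
  refine ⟨hw k, ?_⟩
  induction k with
  | zero => simp [hEF, hEv, hv]
  | succ k ih =>
    rw [pow_succ', Module.End.mul_apply, hEF, ih, hw, map_add, map_smul, map_smul,
      ← Module.End.mul_apply F, ← Module.End.mul_apply F, ← pow_succ']
    push_cast; module

/-- A primitive vector whose weight is not a natural number is zero. -/
lemma prim_zero (H E F : Module.End ℂ V)
    (hF : ∀ v, H (F v) = F (H v) - (2 : ℂ) • F v)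
    (hEF : ∀ v, E (F v) = F (E v) + H v)
    (μ : ℂ) (hμ : ∀ k : ℕ, μ ≠ k) (v : V) (hv : H v = μ • v) (hEv : E v = 0) :
    v = 0 := by
  by_contra hne
  have hP := prim_formula H E F hF hEF μ 0 v (by simp) (by simpa using hv) hEv
  have hnz : ∀ k : ℕ, (F ^ k) v ≠ 0 := by
    intro k
    induction k with
    | zero => simpa using hne
    | succ k ih =>
      intro h
      have := (hP k).2
      rw [h, map_zero, map_zero, smul_zero, add_zero, eq_comm, smul_eq_zero] at this
      rcases this with h | h
      · have h1 : ((k : ℂ) + 1) ≠ 0 := by exact_mod_cast Nat.succ_ne_zero k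
        exact mul_ne_zero h1 (sub_ne_zero.mpr (hμ k)) h
      · exact ih h
  obtain ⟨K, hK⟩ := bounded_weights H μ (-2) (by norm_num)
  refine hnz K (hK K le_rfl _ ?_)
  rw [(hP K).1, map_zero, add_zero]; congr 1; ring

lemma prim_semisimple (H E F : Module.End ℂ V)
    (hF : ∀ v, H (F v) = F (H v) - (2 : ℂ) • F v)
    (hEF : ∀ v, E (F v) = F (E v) + H v)
    (μ : ℕ) (u v : V) (hu : H u = (μ : ℂ) • u) (hv : H v = (μ : ℂ) • v + u)
    (hEu : E u = 0) (hEv : E v = 0) : u = 0 := by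
  by_contra hne
  have hU := prim_formula H E F hF hEF μ 0 u (by simp) (by simpa using hu) hEu
  have hP := prim_formula H E F hF hEF μ u v hu hv hEv
  simp only [map_zero, add_zero, smul_zero] at hU
  have hk1 : ∀ k : ℕ, ((k : ℂ) + 1) ≠ 0 := fun k => by exact_mod_cast Nat.succ_ne_zero k
  have hunz : ∀ k : ℕ, k ≤ μ → (F ^ k) u ≠ 0 := by
    intro k
    induction k with
    | zero => intro _; simpa using hne
    | succ k ih =>
      intro hk h
      have := (hU k).2
      rw [h, map_zero, eq_comm, smul_eq_zero] at this
      rcases this with h | h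
      · refine mul_ne_zero (hk1 k) (sub_ne_zero.mpr ?_) h
        exact_mod_cast (by omega : μ ≠ k)
      · exact ih (by omega) h
  have hu0 : (F ^ (μ + 1)) u = 0 := by
    refine prim_zero H E F hF hEF (-((μ + 2 : ℕ) : ℂ)) ?_ _ ?_ ?_
    · intro k h
      have : ((k + (μ + 2) : ℕ) : ℂ) = 0 := by
        rw [Nat.cast_add, ← h]; ring
      have := Nat.cast_eq_zero.mp this
      omega
    · rw [(hU (μ + 1)).1]; congr 1; push_cast; ring
    · rw [(hU μ).2]; simp
  have hu0' : ∀ j : ℕ, (F ^ (μ + 1 + j)) u = 0 := by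
    intro j
    rw [add_comm, pow_add, Module.End.mul_apply, hu0, map_zero]
  have hvnz : ∀ j : ℕ, (F ^ (μ + 1 + j)) v ≠ 0 := by
    intro j
    induction j with
    | zero =>
      intro h
      have := (hP μ).2
      rw [add_zero] at h
      rw [h, map_zero, sub_self, mul_zero, zero_smul, zero_add, eq_comm, smul_eq_zero] at this
      rcases this with h | h
      · exact hk1 μ h
      · exact hunz μ le_rfl h
    | succ j ih =>
      intro h
      have := (hP (μ + 1 + j)).2
      rw [← add_assoc] at h
      rw [h, map_zero, hu0', smul_zero, add_zero, eq_comm, smul_eq_zero] at this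
      rcases this with h | h
      · refine mul_ne_zero (hk1 _) (sub_ne_zero.mpr ?_) h
        exact_mod_cast (by omega : μ ≠ μ + 1 + j)
      · exact ih h
  obtain ⟨K, hK⟩ := bounded_weights H μ (-2) (by norm_num)
  refine hvnz K (hK (μ + 1 + K) (by omega) _ ?_)
  rw [(hP _).1, hu0', add_zero]; congr 1; ring

lemma semisimple_step (H E F : Module.End ℂ V)
    (hE : ∀ v, H (E v) = E (H v) + (2 : ℂ) • E v)
    (hF : ∀ v, H (F v) = F (H v) - (2 : ℂ) • F v)
    (hEF : ∀ v, E (F v) = F (E v) + H v)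
    (μ : ℕ)
    (hS : ∀ v, H (H v - ((μ + 2 : ℕ) : ℂ) • v) = ((μ + 2 : ℕ) : ℂ) • (H v - ((μ + 2 : ℕ) : ℂ) • v) →
      H v = ((μ + 2 : ℕ) : ℂ) • v)
    (v : V) (hv : H (H v - (μ : ℂ) • v) = (μ : ℂ) • (H v - (μ : ℂ) • v)) :
    H v = (μ : ℂ) • v := by
  have hEv : H (E v) = ((μ + 2 : ℕ) : ℂ) • E v := by
    apply hS
    have e1 : H (E v) - ((μ + 2 : ℕ) : ℂ) • E v = E (H v - (μ : ℂ) • v) := by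
      rw [hE, map_sub, map_smul]; push_cast; module
    rw [e1, hE, hv, map_smul]; push_cast; module
  -- surjectivity of `E F` on the weight space
  let U : Submodule ℂ V := Module.End.eigenspace H ((μ + 2 : ℕ) : ℂ)
  have hmem : ∀ w, w ∈ U ↔ H w = ((μ + 2 : ℕ) : ℂ) • w := fun w =>
    Module.End.mem_eigenspace_iff
  have hmap : ∀ w ∈ U, (E * F) w ∈ U := by
    intro w hw
    rw [hmem] at hw ⊢
    rw [Module.End.mul_apply, hE, hF, hw, map_smul, map_sub, map_smul, map_smul]
    module
  let T : U →ₗ[ℂ] U := (E * F).restrict hmap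
  have hTinj : Function.Injective T := by
    rw [← LinearMap.ker_eq_bot, LinearMap.ker_eq_bot']
    intro w hw
    have : E (F (w : V)) = 0 := congrArg Subtype.val hw
    exact Subtype.ext (EF_inj H E F hE hEF (μ + 2) (by omega) w ((hmem _).mp w.2) this)
  obtain ⟨d, hd⟩ := (LinearMap.injective_iff_surjective.mp hTinj) ⟨E v, (hmem _).mpr hEv⟩
  have hd' : E (F (d : V)) = E v := congrArg Subtype.val hd
  have hdH := (hmem _).mp d.2
  have hFd : H (F (d : V)) = (μ : ℂ) • F (d : V) := by
    rw [hF, hdH, map_smul]; push_cast; module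
  have key : H v - (μ : ℂ) • v = 0 := by
    refine prim_semisimple H E F hF hEF μ (H v - (μ : ℂ) • v) (v - F d) hv ?_ ?_ ?_
    · rw [map_sub, hFd]; module
    · rw [map_sub, map_smul]
      have := hE v
      rw [hEv] at this
      rw [← sub_eq_iff_eq_add] at this
      rw [← this]; push_cast; module
    · rw [map_sub, hd', sub_self]
  exact sub_eq_zero.mp key

lemma semisimple_nat (H E F : Module.End ℂ V)
    (hE : ∀ v, H (E v) = E (H v) + (2 : ℂ) • E v)
    (hF : ∀ v, H (F v) = F (H v) - (2 : ℂ) • F v)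
    (hEF : ∀ v, E (F v) = F (E v) + H v)
    (μ : ℕ) (v : V)
    (hv : H (H v - (μ : ℂ) • v) = (μ : ℂ) • (H v - (μ : ℂ) • v)) :
    H v = (μ : ℂ) • v := by
  obtain ⟨K, hK⟩ := bounded_weights H 0 1 one_ne_zero
  have main : ∀ j μ : ℕ, K ≤ μ + j → ∀ v : V,
      H (H v - (μ : ℂ) • v) = (μ : ℂ) • (H v - (μ : ℂ) • v) → H v = (μ : ℂ) • v := by
    intro j
    induction j with
    | zero =>
      intro μ hμ v hv
      exact sub_eq_zero.mp (hK μ hμ _ (by simpa using hv))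
    | succ j ih =>
      intro μ hμ v hv
      exact semisimple_step H E F hE hF hEF μ (ih (μ + 2) (by omega)) v hv
  exact main K μ (by omega) v hv

end

lemma even_of_alt {W : Type*} [AddCommGroup W] [Module ℂ W] [FiniteDimensional ℂ W]
    (B : LinearMap.BilinForm ℂ W) (hB : ∀ x y, B x y = - B y x)
    (hn : ∀ x, (∀ y, B x y = 0) → x = 0) : Even (Module.finrank ℂ W) := by
  by_contra hodd
  rw [Nat.not_even_iff_odd] at hodd
  let b := Module.finBasis ℂ W
  let M := LinearMap.BilinForm.toMatrix b B
  have hT : M.transpose = -M := by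
    ext i j
    simp [M, LinearMap.BilinForm.toMatrix_apply, hB (b j) (b i)]
  have hdet : M.det = 0 := by
    have h := Matrix.det_transpose M
    rw [hT, Matrix.det_neg, Fintype.card_fin, hodd.neg_one_pow] at h
    have : (2 : ℂ) * M.det = 0 := by linear_combination -h
    simpa using this
  obtain ⟨w, hw, hw0⟩ := Matrix.exists_vecMul_eq_zero_iff.mpr hdet
  apply hw
  have hx : (∑ i, w i • b i) = 0 := by
    apply hn
    intro y
    have : B (∑ i, w i • b i) = 0 := by
      apply b.ext
      intro j
      have := congrFun hw0 j
      simpa [Matrix.vecMul, dotProduct, M, LinearMap.BilinForm.toMatrix_apply] using this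
    rw [this]; rfl
  funext i
  exact (Fintype.linearIndependent_iff.mp b.linearIndependent) w hx i

lemma exists_trace {n : ℕ} (g : Module.Dual ℂ (Matrix (Fin n) (Fin n) ℂ)) :
    ∃ C : Matrix (Fin n) (Fin n) ℂ, ∀ X, g X = Matrix.trace (C * X) := by
  let Φ : Matrix (Fin n) (Fin n) ℂ →ₗ[ℂ] Module.Dual ℂ (Matrix (Fin n) (Fin n) ℂ) :=
    (LinearMap.mul ℂ (Matrix (Fin n) (Fin n) ℂ)).compr₂ (Matrix.traceLinearMap (Fin n) ℂ ℂ)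
  have hinj : Function.Injective Φ := by
    intro A B hAB
    apply Matrix.ext_iff_trace_mul_right.mpr
    intro X
    exact LinearMap.congr_fun hAB X
  have hsurj : Function.Surjective Φ :=
    (LinearMap.injective_iff_surjective_of_finrank_eq_finrank
      (Subspace.dual_finrank_eq).symm).mp hinj
  obtain ⟨C, hC⟩ := hsurj g
  exact ⟨C, fun X => (LinearMap.congr_fun hC X).symm⟩

lemma trace_alt {n : ℕ} (e A A' : Matrix (Fin n) (Fin n) ℂ) :
    Matrix.trace ((e * A - A * e) * A') = -Matrix.trace ((e * A' - A' * e) * A) := by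
  rw [sub_mul, sub_mul, Matrix.trace_sub, Matrix.trace_sub]
  have t1 := Matrix.trace_mul_cycle e A A'
  have t2 := Matrix.trace_mul_cycle A e A'
  have t3 := Matrix.trace_mul_cycle A' A e
  have t4 := Matrix.trace_mul_cycle A' e A
  have t5 := Matrix.trace_mul_cycle A A' e
  linear_combination -t2 - t3 - t4 - t5

end Stmt11

/-- For an `sl₂`-triple `(e, h, f)` of `n × n` complex matrices, the form
`ψ(A, A') = trace ((e*A - A*e) * A')` is (a) alternating, (b) non-degenerate on the
`(-1)`-eigenspace `W` of `ad h`, and (c) `dim W` is even. This encodes that `ω_χ`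
is non-degenerate super-symplectic on the even part of `g(-1)`, which has even
dimension. -/
theorem stmt11 (n : ℕ) (e h f : Matrix (Fin n) (Fin n) ℂ)
    (h1 : h * e - e * h = 2 • e) (h2 : h * f - f * h = -(2 • f))
    (h3 : e * f - f * e = h) :
    (∀ A A' : Matrix (Fin n) (Fin n) ℂ,
      Matrix.trace ((e * A - A * e) * A') = -Matrix.trace ((e * A' - A' * e) * A)) ∧
    (∀ A ∈ negOneEigenspace n h,
      (∀ A' ∈ negOneEigenspace n h, Matrix.trace ((e * A - A * e) * A') = 0) → A = 0) ∧
    Even (Module.finrank ℂ (negOneEigenspace n h)) := by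
  have hnd : ∀ A ∈ negOneEigenspace n h,
      (∀ A' ∈ negOneEigenspace n h, Matrix.trace ((e * A - A * e) * A') = 0) → A = 0 := by
    let ad : Matrix (Fin n) (Fin n) ℂ → Module.End ℂ (Matrix (Fin n) (Fin n) ℂ) := fun x =>
      LinearMap.mulLeft ℂ x - LinearMap.mulRight ℂ x
    have had : ∀ x y, ad x y = x * y - y * x := fun x y => rfl
    have jac : ∀ x y z, ad x (ad y z) = ad y (ad x z) + ad (x * y - y * x) z := by
      intro x y z
      simp only [had]; noncomm_ring
    have hE : ∀ v, ad h (ad e v) = ad e (ad h v) + (2 : ℂ) • ad e v := by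
      intro v
      rw [jac, h1, had (2 • e), had e v, two_smul, two_smul]; noncomm_ring
    have hF : ∀ v, ad h (ad f v) = ad f (ad h v) - (2 : ℂ) • ad f v := by
      intro v
      rw [jac, h2, had (-(2 • f)), had f v, two_smul, two_smul]; noncomm_ring
    have hEF : ∀ v, ad e (ad f v) = ad f (ad e v) + ad h v := by
      intro v
      rw [jac, h3]
    intro A hA hA'
    have hAw : ad h A = -A := hA
    obtain ⟨C, hC⟩ : ∃ C, e * A - A * e = ad h C - C := by
      let φ : Module.Dual ℂ (Matrix (Fin n) (Fin n) ℂ) :=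
        (Matrix.traceLinearMap (Fin n) ℂ ℂ).comp (LinearMap.mulLeft ℂ (e * A - A * e))
      have hφ : φ ∈ (LinearMap.ker (ad h + 1)).dualAnnihilator := by
        rw [Submodule.mem_dualAnnihilator]
        intro X hX
        apply hA' X
        have : ad h X + X = 0 := hX
        exact eq_neg_of_add_eq_zero_left this
      rw [← LinearMap.range_dualMap_eq_dualAnnihilator_ker] at hφ
      obtain ⟨g, hg⟩ := hφ
      obtain ⟨C, hC⟩ := Stmt11.exists_trace g
      refine ⟨-C, ?_⟩
      apply Matrix.ext_iff_trace_mul_right.mpr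
      intro X
      have hX : g (h * X - X * h + X) = Matrix.trace ((e * A - A * e) * X) :=
        LinearMap.congr_fun hg X
      rw [← hX, hC, had]
      have e1 : C * (h * X - X * h + X) = C * h * X - C * X * h + C * X := by noncomm_ring
      have e2 : (h * -C - -C * h - -C) * X = C * h * X - h * C * X + C * X := by noncomm_ring
      rw [e1, e2, Matrix.trace_add, Matrix.trace_add, Matrix.trace_sub, Matrix.trace_sub,
        Matrix.trace_mul_cycle C X h]
    have hEA : ad h (ad e A) = ad e A := by
      rw [hE, hAw, map_neg]; module
    have hC' : ad e A = ad h C - C := hC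
    have hss := Stmt11.semisimple_nat (ad h) (ad e) (ad f) hE hF hEF 1 C (by
      simp only [Nat.cast_one, one_smul]
      rw [← hC', hEA])
    have hEA0 : ad e A = 0 := by
      rw [hC', hss]; simp
    refine Stmt11.prim_zero (ad h) (ad e) (ad f) hF hEF (-1) ?_ A (by simpa using hAw) hEA0
    intro k hk
    have : ((k + 1 : ℕ) : ℂ) = 0 := by push_cast; rw [← hk]; ring
    exact Nat.succ_ne_zero k (Nat.cast_eq_zero.mp this)
  refine ⟨Stmt11.trace_alt e, hnd, ?_⟩
  let B0 : LinearMap.BilinForm ℂ (Matrix (Fin n) (Fin n) ℂ) :=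
    ((LinearMap.mul ℂ (Matrix (Fin n) (Fin n) ℂ)).compr₂ (Matrix.traceLinearMap (Fin n) ℂ ℂ)).comp
      (LinearMap.mulLeft ℂ e - LinearMap.mulRight ℂ e)
  let B : LinearMap.BilinForm ℂ (negOneEigenspace n h) :=
    B0.domRestrict₁₂ (negOneEigenspace n h) (negOneEigenspace n h)
  refine Stmt11.even_of_alt B (fun x y => Stmt11.trace_alt e x y) ?_
  intro x hx
  exact Subtype.ext (hnd x x.2 (fun A' hA' => hx ⟨A', hA'⟩))
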